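/- Let n ≥ 1 and let v = (v_1, …, v_n) ∈ ℝ^n satisfy v_1 > v_2 > … > v_n and v_i − v_{i+1} > n(v_1 − v_i) for all 1 ≤ i < n. Let σ be a permutation of [n] with one-line notation σ_1σ_2…σ_n, and let C_σ = {x ∈ ℝ^n : x_{σ_1} ≥ x_{σ_2} ≥ … ≥ x_{σ_n}}. If p ∈ C_σ is the unique point of C_σ minimizing the Euclidean distance to v, then the number of distinct values among the coordinates p_1, …, p_n equals LRmax(σ), the number of left-to-right maxima of σ. -/

import Mathlib

open Classical

/-- The closed braid region of `σ` is convex, so its nearest point to `v` satisfies the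
variational inequality. -/
theorem inner_sub_le_zero_of_braid_nearest {n : ℕ} {v p : EuclideanSpace ℝ (Fin n)}
    {σ : Equiv.Perm (Fin n)}
    (hp : ∀ s t : Fin n, s ≤ t → p (σ t) ≤ p (σ s))
    (hmin : ∀ x : EuclideanSpace ℝ (Fin n),
      (∀ s t : Fin n, s ≤ t → x (σ t) ≤ x (σ s)) → dist v p ≤ dist v x)
    {z : EuclideanSpace ℝ (Fin n)} (hz : ∀ s t : Fin n, s ≤ t → z (σ t) ≤ z (σ s)) :
    inner ℝ (v - p) (z - p) ≤ 0 := by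
  let K : Set (EuclideanSpace ℝ (Fin n)) := {x | ∀ s t : Fin n, s ≤ t → x (σ t) ≤ x (σ s)}
  have hK : Convex ℝ K := by
    intro x hx y hy a b ha hb _ s t hst
    have h1 := mul_le_mul_of_nonneg_left (hx s t hst) ha
    have h2 := mul_le_mul_of_nonneg_left (hy s t hst) hb
    simpa using add_le_add h1 h2
  have : Nonempty K := ⟨⟨p, hp⟩⟩
  refine (norm_eq_iInf_iff_real_inner_le_zero hK (u := v) (v := p) hp).1 ?_ z hz
  refine le_antisymm (le_ciInf fun w => ?_) (ciInf_le ⟨0, ?_⟩ (⟨p, hp⟩ : K))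
  · simpa [dist_eq_norm] using hmin w w.2
  · rintro _ ⟨w, rfl⟩
    exact norm_nonneg _

/-- Moving the entries of `p` at positions in `P` by `c` inside the closed braid region
does not decrease the distance to `v`. -/
theorem mul_sum_sub_le_zero_of_braid_nearest {n : ℕ} {v p : EuclideanSpace ℝ (Fin n)}
    {σ : Equiv.Perm (Fin n)}
    (hp : ∀ s t : Fin n, s ≤ t → p (σ t) ≤ p (σ s))
    (hmin : ∀ x : EuclideanSpace ℝ (Fin n),
      (∀ s t : Fin n, s ≤ t → x (σ t) ≤ x (σ s)) → dist v p ≤ dist v x)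
    (P : Finset (Fin n)) (c : ℝ)
    (hc : ∀ s t : Fin n, s ≤ t →
      p (σ t) + (if t ∈ P then c else 0) ≤ p (σ s) + (if s ∈ P then c else 0)) :
    c * ∑ s ∈ P, (v (σ s) - p (σ s)) ≤ 0 := by
  have h := inner_sub_le_zero_of_braid_nearest hp hmin
    (z := p + WithLp.toLp 2 fun i => if σ.symm i ∈ P then c else 0)
    (fun s t hst => by simpa using hc s t hst)
  rw [add_sub_cancel_left, PiLp.inner_apply, ← Equiv.sum_comp σ] at h
  rw [Finset.mul_sum]
  simpa [Finset.sum_ite_mem, ite_mul] using h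

theorem sum_sub_le_zero_of_braid_nearest {n : ℕ} {v p : EuclideanSpace ℝ (Fin n)}
    {σ : Equiv.Perm (Fin n)}
    (hp : ∀ s t : Fin n, s ≤ t → p (σ t) ≤ p (σ s))
    (hmin : ∀ x : EuclideanSpace ℝ (Fin n),
      (∀ s t : Fin n, s ≤ t → x (σ t) ≤ x (σ s)) → dist v p ≤ dist v x)
    {P : Finset (Fin n)} (hP : IsLowerSet (P : Set (Fin n))) :
    ∑ s ∈ P, (v (σ s) - p (σ s)) ≤ 0 := by
  have h := mul_sum_sub_le_zero_of_braid_nearest hp hmin P 1 fun s t hst => by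
    have h1 := hp s t hst
    have h2 : t ∈ P → s ∈ P := fun ht => hP hst ht
    split_ifs <;> first | linarith | tauto
  simpa using h

theorem sum_sub_eq_zero_of_braid_nearest {n : ℕ} {v p : EuclideanSpace ℝ (Fin n)}
    {σ : Equiv.Perm (Fin n)}
    (hp : ∀ s t : Fin n, s ≤ t → p (σ t) ≤ p (σ s))
    (hmin : ∀ x : EuclideanSpace ℝ (Fin n),
      (∀ s t : Fin n, s ≤ t → x (σ t) ≤ x (σ s)) → dist v p ≤ dist v x)
    {P : Finset (Fin n)} (hP : ∀ s ∈ P, ∀ t ∉ P, p (σ t) < p (σ s)) :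
    ∑ s ∈ P, (v (σ s) - p (σ s)) = 0 := by
  have hlow : IsLowerSet (P : Set (Fin n)) := fun s t hts hs => by
    by_contra ht
    exact absurd (hP s hs t ht) (hp t s hts).not_gt
  refine le_antisymm (sum_sub_le_zero_of_braid_nearest hp hmin hlow) ?_
  obtain ⟨ε, hε, h⟩ : ∃ ε : ℝ, 0 < ε ∧ ∀ s ∈ P, ∀ t ∉ P, ε ≤ p (σ s) - p (σ t) := by
    have h : ∀ᶠ ε : ℝ in nhdsWithin 0 (Set.Ioi 0),
        ∀ s t, s ∈ P → t ∉ P → ε ≤ p (σ s) - p (σ t) := by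
      refine Filter.eventually_all.2 fun s => Filter.eventually_all.2 fun t => ?_
      by_cases hs : s ∈ P
      · by_cases ht : t ∉ P
        · filter_upwards [Ioo_mem_nhdsGT (sub_pos.2 (hP s hs t ht))] with ε hε _ _
          exact hε.2.le
        · exact Filter.Eventually.of_forall fun _ _ h => absurd h ht
      · exact Filter.Eventually.of_forall fun _ h => absurd h hs
    obtain ⟨ε, h1, h2⟩ := (h.and self_mem_nhdsWithin).exists
    exact ⟨ε, h2, fun s hs t ht => h1 s t hs ht⟩
  have h := mul_sum_sub_le_zero_of_braid_nearest hp hmin P (-ε) fun s t hst => by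
    have h1 := hp s t hst
    have h2 : t ∈ P → s ∈ P := fun ht => hlow hst ht
    by_cases hs : s ∈ P <;> by_cases ht : t ∈ P
    · simpa [hs, ht] using h1
    · have := h s hs t ht
      simp only [hs, ht, if_true, if_false]
      linarith
    · exact absurd (h2 ht) hs
    · simpa [hs, ht] using h1
  by_contra! hneg
  nlinarith

theorem mul_sub_lt_sub_of_lt {n : ℕ} (hn : 1 ≤ n) {v : EuclideanSpace ℝ (Fin n)}
    (hv1 : ∀ i j : Fin n, i < j → v j < v i)
    (hv2 : ∀ i : ℕ, ∀ h : i + 1 < n,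
      (n : ℝ) * (v ⟨0, hn⟩ - v ⟨i, Nat.lt_of_succ_lt h⟩) <
        v ⟨i, Nat.lt_of_succ_lt h⟩ - v ⟨i + 1, h⟩)
    {i j : Fin n} (hij : i < j) :
    (n : ℝ) * (v ⟨0, hn⟩ - v i) < v ⟨0, hn⟩ - v j := by
  have hle : ∀ a b : Fin n, a ≤ b → v b ≤ v a := fun a b hab =>
    hab.eq_or_lt.elim (fun h => h ▸ le_rfl) fun h => (hv1 a b h).le
  have hlt : (i : ℕ) + 1 < n := by omega
  have h1 := hv2 i hlt
  have h2 := hle ⟨i + 1, hlt⟩ j (Fin.mk_le_of_le_val (by omega))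
  have h3 := hle ⟨0, hn⟩ i (Fin.mk_le_of_le_val (by omega))
  rw [Fin.eta] at h1
  linarith

/-- A position at which the nearest point drops strictly below all earlier entries is a
left-to-right maximum. -/
theorem lrMax_of_forall_lt {n : ℕ} (hn : 1 ≤ n) {v p : EuclideanSpace ℝ (Fin n)}
    {σ : Equiv.Perm (Fin n)}
    (hle : ∀ i, v i ≤ v ⟨0, hn⟩)
    (hgap : ∀ i j : Fin n, i < j → (n : ℝ) * (v ⟨0, hn⟩ - v i) < v ⟨0, hn⟩ - v j)
    (hp : ∀ s t : Fin n, s ≤ t → p (σ t) ≤ p (σ s))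
    (hmin : ∀ x : EuclideanSpace ℝ (Fin n),
      (∀ s t : Fin n, s ≤ t → x (σ t) ≤ x (σ s)) → dist v p ≤ dist v x)
    {t : Fin n} (ht : ∀ s < t, p (σ t) < p (σ s)) {j : Fin n} (hjt : j < t) : σ j < σ t := by
  by_contra! hle'
  have hlt : σ t < σ j := lt_of_le_of_ne hle' fun h => hjt.ne' (σ.injective h)
  have h0 : ∑ s ∈ Finset.Iio t, (v (σ s) - p (σ s)) = 0 :=
    sum_sub_eq_zero_of_braid_nearest hp hmin fun s hs u hu =>
      (hp t u (by simpa using hu)).trans_lt (ht s (by simpa using hs))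
  have h1 : ∑ s ∈ Finset.Iic t, (v (σ s) - p (σ s)) ≤ 0 :=
    sum_sub_le_zero_of_braid_nearest hp hmin (by simpa using isLowerSet_Iic t)
  have h2 : ∑ s ∈ Finset.Iio j, (v (σ s) - p (σ s)) ≤ 0 :=
    sum_sub_le_zero_of_braid_nearest hp hmin (by simpa using isLowerSet_Iio j)
  rw [← Finset.Iio_insert t, Finset.sum_insert (by simp), h0] at h1
  have hsub : Finset.Iio j ⊆ Finset.Iio t := Finset.Iio_subset_Iio hjt.le
  rw [← Finset.sum_sdiff hsub] at h0
  set Q := Finset.Iio t \ Finset.Iio j with hQ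
  have hj : j ∈ Q := by simp [hQ, hjt]
  have h3 : v ⟨0, hn⟩ - v (σ j) ≤ ∑ s ∈ Q, (v ⟨0, hn⟩ - v (σ s)) :=
    Finset.single_le_sum (f := fun s => v ⟨0, hn⟩ - v (σ s))
      (fun s _ => sub_nonneg.2 (hle _)) hj
  have h4 : ∑ s ∈ Q, (v ⟨0, hn⟩ - v (σ s)) + ∑ s ∈ Q, (v (σ s) - p (σ s))
      ≤ Q.card • (v ⟨0, hn⟩ - v (σ t)) := by
    rw [← Finset.sum_add_distrib]
    refine Finset.sum_le_card_nsmul _ _ _ fun s hs => ?_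
    have := ht s (by simp [hQ] at hs; exact hs.1)
    linarith
  have h5 : (Q.card : ℝ) ≤ n := by exact_mod_cast (Finset.card_le_univ Q).trans_eq (by simp)
  rw [nsmul_eq_mul] at h4
  have h6 := mul_le_mul_of_nonneg_right h5 (sub_nonneg.2 (hle (σ t)))
  linarith [hgap _ _ hlt]

/-- The nearest point drops strictly at every left-to-right maximum. -/
theorem lt_of_lrMax {n : ℕ} (hn : 1 ≤ n) {v p : EuclideanSpace ℝ (Fin n)}
    {σ : Equiv.Perm (Fin n)}
    (hle : ∀ i, v i ≤ v ⟨0, hn⟩)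
    (hgap : ∀ i j : Fin n, i < j → (n : ℝ) * (v ⟨0, hn⟩ - v i) < v ⟨0, hn⟩ - v j)
    (hp : ∀ s t : Fin n, s ≤ t → p (σ t) ≤ p (σ s))
    (hmin : ∀ x : EuclideanSpace ℝ (Fin n),
      (∀ s t : Fin n, s ≤ t → x (σ t) ≤ x (σ s)) → dist v p ≤ dist v x)
    {t : Fin n} (ht : ∀ j < t, σ j < σ t) {s : Fin n} (hst : s < t) : p (σ t) < p (σ s) := by
  refine lt_of_le_of_ne (hp s t hst.le) fun heq => ?_
  set c := p (σ t) with hc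
  let A : Finset (Fin n) := Finset.univ.filter fun u => c < p (σ u)
  let B : Finset (Fin n) := Finset.univ.filter fun u => c ≤ p (σ u)
  have hA : ∑ u ∈ A, (v (σ u) - p (σ u)) = 0 :=
    sum_sub_eq_zero_of_braid_nearest hp hmin fun a ha b hb => by
      simp only [A, Finset.mem_filter, Finset.mem_univ, true_and, not_lt] at ha hb
      exact hb.trans_lt ha
  have hB : ∑ u ∈ B, (v (σ u) - p (σ u)) = 0 :=
    sum_sub_eq_zero_of_braid_nearest hp hmin fun a ha b hb => by
      simp only [B, Finset.mem_filter, Finset.mem_univ, true_and, not_le] at ha hb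
      exact hb.trans_le ha
  have hI : ∑ u ∈ Finset.Iio t, (v (σ u) - p (σ u)) ≤ 0 :=
    sum_sub_le_zero_of_braid_nearest hp hmin (by simpa using isLowerSet_Iio t)
  have hAI : A ⊆ Finset.Iio t := fun u hu => by
    simp only [A, Finset.mem_filter, Finset.mem_univ, true_and] at hu
    by_contra hut
    exact (hp t u (by simpa using hut)).not_gt hu
  have hIB : Finset.Iio t ⊆ B := fun u hu => by
    simpa [B] using hp u t (Finset.mem_Iio.1 hu).le
  rw [← Finset.sum_sdiff hIB] at hB
  have hI' := hI
  rw [← Finset.sum_sdiff hAI, hA, add_zero] at hI'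
  obtain ⟨r, hr, hrc⟩ : ∃ r ∈ Finset.Iio t \ A, v (σ r) - p (σ r) ≤ 0 := by
    refine Finset.exists_le_of_sum_le (g := fun _ => (0 : ℝ)) ⟨s, ?_⟩ (by simpa using hI')
    simp [A, hst, ← heq]
  simp only [A, Finset.mem_sdiff, Finset.mem_Iio, Finset.mem_filter, Finset.mem_univ, true_and,
    not_lt] at hr
  set Q := B \ Finset.Iio t with hQ
  have htQ : t ∈ Q := by simp [hQ, B, hc]
  have h3 : v ⟨0, hn⟩ - v (σ t) ≤ ∑ u ∈ Q, (v ⟨0, hn⟩ - v (σ u)) :=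
    Finset.single_le_sum (f := fun u => v ⟨0, hn⟩ - v (σ u))
      (fun u _ => sub_nonneg.2 (hle _)) htQ
  have h4 : ∑ u ∈ Q, (v ⟨0, hn⟩ - v (σ u)) + ∑ u ∈ Q, (v (σ u) - p (σ u))
      ≤ Q.card • (v ⟨0, hn⟩ - v (σ r)) := by
    rw [← Finset.sum_add_distrib]
    refine Finset.sum_le_card_nsmul _ _ _ fun u hu => ?_
    have : c ≤ p (σ u) := by
      simp only [hQ, B, Finset.mem_sdiff, Finset.mem_filter, Finset.mem_univ, true_and] at hu
      exact hu.1
    linarith [hr.2]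
  have h5 : (Q.card : ℝ) ≤ n := by exact_mod_cast (Finset.card_le_univ Q).trans_eq (by simp)
  rw [nsmul_eq_mul] at h4
  have h6 := mul_le_mul_of_nonneg_right h5 (sub_nonneg.2 (hle (σ r)))
  linarith [hgap _ _ (ht r hr.1)]

/-- For `v` with `v₁ > ⋯ > vₙ` and `vᵢ − vᵢ₊₁ > n(v₁ − vᵢ)`,
the nearest point `p` of the closed braid region `C_σ` to `v` has exactly
`LRmax σ` distinct coordinate values. -/
theorem braid_projection_LRmax {n : ℕ} (hn : 1 ≤ n)
    (v : EuclideanSpace ℝ (Fin n))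
    (hv1 : ∀ i j : Fin n, i < j → v j < v i)
    (hv2 : ∀ i : ℕ, ∀ h : i + 1 < n,
      (n : ℝ) * (v ⟨0, by omega⟩ - v ⟨i, by omega⟩) < v ⟨i, by omega⟩ - v ⟨i + 1, h⟩)
    (σ : Equiv.Perm (Fin n)) (p : EuclideanSpace ℝ (Fin n))
    (hp : ∀ s t : Fin n, s ≤ t → p (σ t) ≤ p (σ s))
    (hmin : ∀ x : EuclideanSpace ℝ (Fin n),
      (∀ s t : Fin n, s ≤ t → x (σ t) ≤ x (σ s)) → dist v p ≤ dist v x) :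
    (Finset.univ.image fun i : Fin n => p i).card =
      (Finset.univ.filter fun i : Fin n => ∀ j : Fin n, j < i → σ j < σ i).card := by
  have hgap : ∀ i j : Fin n, i < j → (n : ℝ) * (v ⟨0, hn⟩ - v i) < v ⟨0, hn⟩ - v j :=
    fun i j => mul_sub_lt_sub_of_lt hn hv1 hv2
  have hle : ∀ i, v i ≤ v ⟨0, hn⟩ := fun i =>
    (Fin.mk_le_of_le_val (Nat.zero_le _) : (⟨0, hn⟩ : Fin n) ≤ i).eq_or_lt.elim
      (fun h => h ▸ le_rfl) fun h => (hv1 _ _ h).le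
  let L : Finset (Fin n) := Finset.univ.filter fun i : Fin n => ∀ j : Fin n, j < i → σ j < σ i
  have hinj : Set.InjOn (fun s => p (σ s)) (L : Set (Fin n)) := by
    intro a ha b hb hab
    simp only [L, Finset.coe_filter, Finset.mem_univ, true_and, Set.mem_ofPred_eq] at ha hb
    rcases lt_trichotomy a b with h | h | h
    · exact absurd hab (lt_of_lrMax hn hle hgap hp hmin hb h).ne'
    · exact h
    · exact absurd hab (lt_of_lrMax hn hle hgap hp hmin ha h).ne
  change _ = L.card
  rw [← Finset.card_image_of_injOn hinj]
  congr 1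
  ext y
  simp only [Finset.mem_image, Finset.mem_univ, true_and]
  constructor
  · rintro ⟨i, rfl⟩
    obtain ⟨l, hl, hmin_l⟩ := WellFounded.has_min (wellFounded_lt (α := Fin n))
      {s | p (σ s) = p i} ⟨σ.symm i, by simp⟩
    refine ⟨l, ?_, hl⟩
    simp only [L, Finset.mem_filter, Finset.mem_univ, true_and]
    refine fun j hj => lrMax_of_forall_lt hn hle hgap hp hmin (fun s hs => ?_) hj
    exact lt_of_le_of_ne (hp s l hs.le) fun h => hmin_l s (h.symm.trans hl) hs
  · rintro ⟨s, _, rfl⟩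
    exact ⟨σ s, rfl⟩
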